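/- Let k ≥ 2 and m₁,…,m_k ≥ 4. Two points ((x₁,q₁),…,(x_k,q_k)) and ((y₁,p₁),…,(y_k,p_k)) of S^{m₁} × ⋯ × S^{m_k} lie in the same Sp(1)^{k−1}-orbit if and only if (x₁, x₂, …, x_k, q₁q₂⋯q_k) = (y₁, y₂, …, y_k, p₁p₂⋯p_k); that is, the fibers of the map ((x₁,q₁),…,(x_k,q_k)) ↦ (x₁, …, x_k, q₁q₂⋯q_k) are exactly the orbits of the action. -/

import Mathlib

open scoped BigOperators

noncomputable section

def chainExt (k : ℕ) {G : Type*} [One G] (r : Fin (k - 1) → G) (j : ℕ) : G :=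
  if h : 1 ≤ j ∧ j ≤ k - 1 then r ⟨j - 1, by omega⟩ else 1

/-- The sphere `S^{m i} = {(x, q) ∈ ℝ^{m i - 3} × ℍ : |x|² + |q|² = 1}`. -/
abbrev SpSphere (n : ℕ) : Type :=
  {p : EuclideanSpace ℝ (Fin n) × Quaternion ℝ // ‖p.1‖ ^ 2 + ‖p.2‖ ^ 2 = 1}

/-- The orbit relation of the action of `Sp(1)^{k-1}` on `S^{m₁} × ⋯ × S^{m_k}` by
`(r₁,…,r_{k-1})·((x₁,q₁),…,(x_k,q_k)) = ((x₁, q₁r₁⁻¹), (x₂, r₁q₂r₂⁻¹), …, (x_k, r_{k-1}q_k))`. -/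
def spRel (k : ℕ) (m : Fin k → ℕ) (a b : ∀ i : Fin k, SpSphere (m i - 3)) : Prop :=
  ∃ r : Fin (k - 1) → Quaternion ℝ, (∀ j, ‖r j‖ = 1) ∧
    ∀ i : Fin k, (b i).1.1 = (a i).1.1 ∧
      (b i).1.2 = chainExt k r (i : ℕ) * (a i).1.2 * (chainExt k r ((i : ℕ) + 1))⁻¹

theorem prod_ofFn_eq_of_chain {D : Type*} [DivisionRing D] {n : ℕ} (R : Fin (n + 1) → D)
    (hR : ∀ i, R i ≠ 0) (q p : Fin n → D)
    (h : ∀ i, p i = R i.castSucc * q i * (R i.succ)⁻¹) :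
    (List.ofFn p).prod = R 0 * (List.ofFn q).prod * (R (Fin.last n))⁻¹ := by
  induction n with
  | zero => simp [hR]
  | succ n ih =>
    have hrest := ih (fun i => R i.succ) (fun i => hR _) (fun i => q i.succ) (fun i => p i.succ)
      (fun i => by simpa using h i.succ)
    rw [List.ofFn_succ, List.prod_cons, hrest, h 0, List.ofFn_succ, List.prod_cons]
    simp only [Fin.castSucc_zero, Fin.succ_last, mul_assoc]
    rw [inv_mul_cancel_left₀ (hR _)]

/-- Sequences of matching norms whose products differ by unit factors at the two ends are
related by a chain of unit elements with these ends. -/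
theorem exists_chain_of_prod_ofFn_eq {D : Type*} [NormedDivisionRing D] {n : ℕ} (q p : Fin n → D)
    (hqp : ∀ i, ‖q i‖ = ‖p i‖) (s t : D) (hs : ‖s‖ = 1) (ht : ‖t‖ = 1)
    (h : (List.ofFn p).prod = s * (List.ofFn q).prod * t⁻¹) :
    ∃ R : Fin (n + 1) → D, (∀ i, ‖R i‖ = 1) ∧ R 0 = s ∧ R (Fin.last n) = t ∧
      ∀ i, p i = R i.castSucc * q i * (R i.succ)⁻¹ := by
  induction n generalizing s with
  | zero =>
    have ht0 : t ≠ 0 := norm_ne_zero_iff.mp (by simp [ht])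
    have hst : s = t := by
      simp only [List.ofFn_zero, List.prod_nil, mul_one] at h
      exact ((mul_inv_eq_one₀ ht0).mp h.symm)
    exact ⟨fun _ => s, fun _ => hs, rfl, hst, fun i => i.elim0⟩
  | succ n ih =>
    have hs0 : s ≠ 0 := norm_ne_zero_iff.mp (by simp [hs])
    have ht0 : t ≠ 0 := norm_ne_zero_iff.mp (by simp [ht])
    set Q := (List.ofFn fun i : Fin n => q i.succ).prod with hQ
    set P := (List.ofFn fun i : Fin n => p i.succ).prod with hP
    have hQP : ‖Q‖ = ‖P‖ := by
      rw [hQ, hP, List.norm_prod, List.norm_prod, List.map_ofFn, List.map_ofFn]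
      congr 2
      exact funext fun i => hqp i.succ
    rw [List.ofFn_succ, List.prod_cons, List.ofFn_succ, List.prod_cons, ← hQ, ← hP] at h
    obtain ⟨u, hu, hu1, hu2⟩ : ∃ u : D, ‖u‖ = 1 ∧ p 0 = s * q 0 * u⁻¹ ∧ P = u * Q * t⁻¹ := by
      by_cases hq : q 0 = 0
      · have hp : p 0 = 0 := by rw [← norm_eq_zero, ← hqp, hq, norm_zero]
        by_cases hQ0 : Q = 0
        · have hP0 : P = 0 := by rw [← norm_eq_zero, ← hQP, hQ0, norm_zero]
          exact ⟨1, norm_one, by simp [hq, hp], by simp [hQ0, hP0]⟩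
        · refine ⟨P * t * Q⁻¹, ?_, by simp [hq, hp], ?_⟩
          · rw [norm_mul, norm_mul, norm_inv, ht, ← hQP, mul_one,
              mul_inv_cancel₀ (norm_ne_zero_iff.mpr hQ0)]
          · rw [inv_mul_cancel_right₀ hQ0, mul_inv_cancel_right₀ ht0]
      · have hp : p 0 ≠ 0 := by rwa [← norm_ne_zero_iff, ← hqp, norm_ne_zero_iff]
        refine ⟨(p 0)⁻¹ * s * q 0, ?_, ?_, ?_⟩
        · rw [norm_mul, norm_mul, norm_inv, hs, ← hqp, mul_one,
            inv_mul_cancel₀ (norm_ne_zero_iff.mpr hq)]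
        · rw [mul_assoc (p 0)⁻¹, mul_inv_rev, inv_inv,
            mul_inv_cancel_left₀ (mul_ne_zero hs0 hq)]
        · apply mul_left_cancel₀ hp
          rw [h]
          simp only [mul_assoc]
          rw [mul_inv_cancel_left₀ hp]
    obtain ⟨R, hR, hR0, hRl, hRi⟩ :=
      ih (fun i => q i.succ) (fun i => p i.succ) (fun i => hqp i.succ) u hu hu2
    refine ⟨Fin.cons s R, ?_, rfl, ?_, ?_⟩
    · intro i
      cases i using Fin.cases with
      | zero => exact hs
      | succ i => exact hR i
    · rw [← Fin.succ_last, Fin.cons_succ, hRl]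
    · intro i
      cases i using Fin.cases with
      | zero => rw [Fin.castSucc_zero, Fin.cons_zero, Fin.cons_succ, hR0, hu1]
      | succ i => rw [← Fin.succ_castSucc, Fin.cons_succ, Fin.cons_succ]; exact hRi i

theorem chainExt_zero (k : ℕ) {G : Type*} [One G] (r : Fin (k - 1) → G) :
    chainExt k r 0 = 1 := by
  simp [chainExt]

theorem chainExt_self {k : ℕ} (hk : 1 ≤ k) {G : Type*} [One G] (r : Fin (k - 1) → G) :
    chainExt k r k = 1 :=
  dif_neg (by omega)

theorem norm_chainExt {k : ℕ} {D : Type*} [NormedDivisionRing D] {r : Fin (k - 1) → D}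
    (hr : ∀ j, ‖r j‖ = 1) (j : ℕ) : ‖chainExt k r j‖ = 1 := by
  unfold chainExt
  split_ifs
  · exact hr _
  · exact norm_one

theorem chainExt_eq_of_ends_eq_one {k : ℕ} {G : Type*} [One G] (R : Fin (k + 1) → G)
    (h0 : R 0 = 1) (hl : R (Fin.last k) = 1) (j : Fin (k + 1)) :
    chainExt k (fun i : Fin (k - 1) => R ⟨i + 1, by omega⟩) j = R j := by
  unfold chainExt
  split_ifs with h
  · exact congrArg R (Fin.ext (Nat.sub_add_cancel h.1))
  · obtain hj | hj : j = 0 ∨ j = Fin.last k := by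
      simp only [Fin.ext_iff, Fin.val_zero, Fin.val_last]
      omega
    · rw [hj, h0]
    · rw [hj, hl]

/-- two points of `S^{m₁} × ⋯ × S^{m_k}` lie in the same `Sp(1)^{k-1}`-orbit iff
they have the same `x`-components and the same ordered product `q₁q₂⋯q_k`; i.e. the fibers of
`((x₁,q₁),…,(x_k,q_k)) ↦ (x₁, …, x_k, q₁q₂⋯q_k)` are exactly the orbits. -/
theorem stmt6 (k : ℕ) (hk : 2 ≤ k) (m : Fin k → ℕ) (hm : ∀ i, 4 ≤ m i)
    (a b : ∀ i : Fin k, SpSphere (m i - 3)) :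
    spRel k m a b ↔
      ((∀ i, (a i).1.1 = (b i).1.1) ∧
        (List.ofFn fun i => (a i).1.2).prod = (List.ofFn fun i => (b i).1.2).prod) := by
  constructor
  · rintro ⟨r, hr, h⟩
    refine ⟨fun i => (h i).1.symm, ?_⟩
    have hprod := prod_ofFn_eq_of_chain (fun j : Fin (k + 1) => chainExt k r j)
      (fun j => norm_ne_zero_iff.mp (by rw [norm_chainExt hr]; exact one_ne_zero))
      (fun i => (a i).1.2) (fun i => (b i).1.2) (fun i => (h i).2)
    simpa [chainExt_zero, chainExt_self (by omega : 1 ≤ k)] using hprod.symm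
  · rintro ⟨hx, hprod⟩
    have hnorm : ∀ i, ‖(a i).1.2‖ = ‖(b i).1.2‖ := fun i => by
      have ha := (a i).2.trans (b i).2.symm
      rw [hx i] at ha
      exact (sq_eq_sq₀ (norm_nonneg _) (norm_nonneg _)).mp (add_left_cancel ha)
    obtain ⟨R, hR, hR0, hRl, hRi⟩ := exists_chain_of_prod_ofFn_eq (fun i => (a i).1.2)
      (fun i => (b i).1.2) hnorm 1 1 norm_one norm_one (by simpa using hprod.symm)
    refine ⟨fun i => R ⟨i + 1, by omega⟩, fun i => hR _, fun i => ⟨(hx i).symm, ?_⟩⟩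
    have hchain := chainExt_eq_of_ends_eq_one R hR0 hRl
    rw [hRi i, ← hchain i.castSucc, ← hchain i.succ]
    rfl
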